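/- For all integers ℓ ≥ 2 and r > k ≥ 2 and m > r, D_r(m,k;ℓ) ≥ R_{r−k}(⌈m/(k+1)⌉ − k; ℓ). -/

import Mathlib

/-- The coloring `φ` of the `r`-element subsets of `[n]` admits a monochromatic
set `Y` of size `m`: all `r`-element subsets of `Y` get the same color. -/
def HasMonoClique (n r m ℓ : ℕ) (φ : Finset ℕ → Fin ℓ) : Prop :=
  ∃ Y : Finset ℕ, Y ⊆ Finset.range n ∧ Y.card = m ∧
    ∃ c : Fin ℓ, ∀ P ⊆ Y, P.card = r → φ P = c

/-- `R_r(m;ℓ)`: the classical hypergraph Ramsey number. -/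
noncomputable def ramsey (r m ℓ : ℕ) : ℕ :=
  sInf {n | ∀ φ : Finset ℕ → Fin ℓ, HasMonoClique n r m ℓ φ}

/-- The coloring `φ` of the `(k+r)`-element subsets of `[n]` admits a monochromatic
`(r,m,k)`-daisy: disjoint sets `K, M ⊆ [n]` with `|K| = k`, `|M| = m` such that `φ`
is constant on `{K ∪ P : P ⊆ M, |P| = r}`. -/
def HasMonoDaisyK (n r m k ℓ : ℕ) (φ : Finset ℕ → Fin ℓ) : Prop :=
  ∃ K M : Finset ℕ, K ⊆ Finset.range n ∧ M ⊆ Finset.range n ∧ Disjoint K M ∧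
    K.card = k ∧ M.card = m ∧ ∃ c : Fin ℓ, ∀ P ⊆ M, P.card = r → φ (K ∪ P) = c

/-- `D_r(m,k;ℓ)`: the least `n` such that every `ℓ`-coloring of the `(k+r)`-element
subsets of `[n]` admits a monochromatic `(r,m,k)`-daisy. -/
noncomputable def daisyRamseyK (r m k ℓ : ℕ) : ℕ :=
  sInf {n | ∀ φ : Finset ℕ → Fin ℓ, HasMonoDaisyK n r m k ℓ φ}

/-- As `HasMonoDaisyK`, additionally requiring the daisy to be *simple*: every element
of the kernel `K` is either below all of `M` or above all of `M`. -/
def HasMonoSimpleDaisyK (n r m k ℓ : ℕ) (φ : Finset ℕ → Fin ℓ) : Prop :=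
  ∃ K M : Finset ℕ, K ⊆ Finset.range n ∧ M ⊆ Finset.range n ∧ Disjoint K M ∧
    K.card = k ∧ M.card = m ∧ (∀ x ∈ K, (∀ y ∈ M, x < y) ∨ (∀ y ∈ M, y < x)) ∧
    ∃ c : Fin ℓ, ∀ P ⊆ M, P.card = r → φ (K ∪ P) = c

/-- `D_r^smp(m,k;ℓ)`: the least `n` such that every `ℓ`-coloring of the `(k+r)`-element
subsets of `[n]` admits a monochromatic simple `(r,m,k)`-daisy. -/
noncomputable def simpleDaisyRamseyK (r m k ℓ : ℕ) : ℕ :=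
  sInf {n | ∀ φ : Finset ℕ → Fin ℓ, HasMonoSimpleDaisyK n r m k ℓ φ}

theorem ramsey_aux (ℓ : ℕ) (hℓ : 0 < ℓ) (r : ℕ) : ∀ m : ℕ, ∃ n : ℕ, ∀ S : Finset ℕ, n ≤ S.card →
    ∀ φ : Finset ℕ → Fin ℓ, ∃ Y ⊆ S, Y.card = m ∧ ∃ c : Fin ℓ, ∀ P ⊆ Y, P.card = r → φ P = c := by
  induction r with
  | zero =>
    intro m
    refine ⟨m, fun S hS φ => ?_⟩
    obtain ⟨Y, hY, hc⟩ := Finset.exists_subset_card_eq hS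
    refine ⟨Y, hY, hc, φ ∅, fun P _ hP => ?_⟩
    rw [Finset.card_eq_zero.1 hP]
  | succ r ih =>
    have key : ∀ t : ℕ, ∃ N : ℕ, ∀ S : Finset ℕ, N ≤ S.card → ∀ φ : Finset ℕ → Fin ℓ,
        ∃ T ⊆ S, T.card = t ∧ ∀ x ∈ T, ∃ c : Fin ℓ, ∀ P ⊆ T, (∀ y ∈ P, x < y) → P.card = r →
          φ (insert x P) = c := by
      intro t
      induction t with
      | zero => exact ⟨0, fun S _ φ => ⟨∅, by simp, by simp, by simp⟩⟩
      | succ t iht =>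
        obtain ⟨N, hN⟩ := iht
        obtain ⟨n, hn⟩ := ih N
        refine ⟨n + 1, fun S hS φ => ?_⟩
        have hne : S.Nonempty := Finset.card_pos.1 (by omega)
        have hmem := S.min'_mem hne
        set x := S.min' hne with hx
        obtain ⟨Y, hYS, hYc, c, hc⟩ := hn (S.erase x)
          (by rw [Finset.card_erase_of_mem hmem]; omega) (fun P => φ (insert x P))
        obtain ⟨T, hTY, hTc, hT⟩ := hN Y hYc.ge φ
        have hlt : ∀ y ∈ T, x < y := by
          intro y hy
          have h1 := Finset.mem_erase.1 (hYS (hTY hy))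
          exact lt_of_le_of_ne (S.min'_le y h1.2) (Ne.symm h1.1)
        have hxT : x ∉ T := fun h => lt_irrefl _ (hlt x h)
        refine ⟨insert x T, ?_, by rw [Finset.card_insert_of_notMem hxT, hTc], ?_⟩
        · intro y hy
          rcases Finset.mem_insert.1 hy with rfl | hy
          · exact hmem
          · exact Finset.mem_of_mem_erase (hYS (hTY hy))
        · intro y hy
          have aux : ∀ P ⊆ insert x T, (∀ z ∈ P, y < z) → P ⊆ T := by
            intro P hP hz z hzP
            rcases Finset.mem_insert.1 (hP hzP) with h | h
            · exfalso
              have h2 := hz z hzP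
              rcases Finset.mem_insert.1 hy with h3 | h3
              · omega
              · have := hlt y h3
                omega
            · exact h
          rcases Finset.mem_insert.1 hy with h | h
          · refine ⟨c, fun P hP hz hPc => ?_⟩
            rw [h]
            exact hc P ((aux P hP hz).trans hTY) hPc
          · obtain ⟨d, hd⟩ := hT y h
            exact ⟨d, fun P hP hz hPc => hd P (aux P hP hz) hz hPc⟩
    intro m
    obtain ⟨N, hN⟩ := key (ℓ * m + 1)
    refine ⟨N, fun S hS φ => ?_⟩
    obtain ⟨T, hTS, hTc, hT⟩ := hN S hS φ
    have hT' : ∀ x : ℕ, ∃ c : Fin ℓ, x ∈ T → ∀ P ⊆ T, (∀ y ∈ P, x < y) → P.card = r →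
          φ (insert x P) = c := by
      intro x
      by_cases h : x ∈ T
      · obtain ⟨c, hc⟩ := hT x h
        exact ⟨c, fun _ => hc⟩
      · exact ⟨⟨0, hℓ⟩, fun h' => absurd h' h⟩
    choose f hf using hT'
    obtain ⟨c, -, hc⟩ := Finset.exists_lt_card_fiber_of_mul_lt_card_of_maps_to
      (s := T) (t := (Finset.univ : Finset (Fin ℓ))) (f := f) (n := m)
      (fun a _ => Finset.mem_univ _) (by rw [Finset.card_univ, Fintype.card_fin, hTc]; omega)
    obtain ⟨Y, hY, hYc⟩ := Finset.exists_subset_card_eq hc.le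
    refine ⟨Y, fun y hy => hTS (Finset.mem_filter.1 (hY hy)).1, hYc, c, fun P hP hPc => ?_⟩
    have hne : P.Nonempty := Finset.card_pos.1 (by omega)
    have hmem := P.min'_mem hne
    have hx := Finset.mem_filter.1 (hY (hP hmem))
    have h := hf (P.min' hne) hx.1 (P.erase (P.min' hne))
      (fun y hy => (Finset.mem_filter.1 (hY (hP (Finset.mem_of_mem_erase hy)))).1)
      (fun y hy => P.min'_lt_of_mem_erase_min' hne hy)
      (by rw [Finset.card_erase_of_mem hmem]; omega)
    rw [Finset.insert_erase hmem, hx.2] at h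
    exact h

theorem exists_initial (i : ℕ) : ∀ S : Finset ℕ, i ≤ S.card →
    ∃ A ⊆ S, A.card = i ∧ ∀ x ∈ A, ∀ y ∈ S \ A, x < y := by
  induction i with
  | zero => exact fun S _ => ⟨∅, by simp, by simp, by simp⟩
  | succ i ih =>
    intro S hS
    have hne : S.Nonempty := Finset.card_pos.1 (by omega)
    have hmem := S.min'_mem hne
    obtain ⟨A, hA, hAc, hlt⟩ := ih (S.erase (S.min' hne))
      (by rw [Finset.card_erase_of_mem hmem]; omega)
    have hx : S.min' hne ∉ A := fun h => absurd (hA h) (by simp)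
    refine ⟨insert (S.min' hne) A, ?_, by rw [Finset.card_insert_of_notMem hx, hAc], ?_⟩
    · exact Finset.insert_subset hmem (hA.trans (Finset.erase_subset _ _))
    · intro x hx y hy
      simp only [Finset.mem_sdiff, Finset.mem_insert, not_or] at hy
      rcases Finset.mem_insert.1 hx with rfl | h
      · exact lt_of_le_of_ne (S.min'_le y hy.1) (Ne.symm hy.2.1)
      · exact hlt x h y (by simp [hy])

/-- The elements with at least `k` elements below and above. -/
def midPart (k : ℕ) (X : Finset ℕ) : Finset ℕ :=
  X.filter (fun x => k ≤ (X.filter (fun y => y < x)).card ∧ k ≤ (X.filter (fun y => x < y)).card)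

theorem midPart_eq (k : ℕ) (L Q U : Finset ℕ) (hL : L.card = k) (hU : U.card = k)
    (h1 : ∀ x ∈ L, ∀ y ∈ Q, x < y) (h2 : ∀ x ∈ Q, ∀ y ∈ U, x < y)
    (h3 : ∀ x ∈ L, ∀ y ∈ U, x < y) : midPart k (L ∪ Q ∪ U) = Q := by
  ext x
  simp only [midPart, Finset.mem_filter]
  constructor
  · rintro ⟨hx, hb, ha⟩
    rcases Finset.mem_union.1 hx with hx | hx
    · rcases Finset.mem_union.1 hx with hx | hx
      · exfalso
        have hsub : (L ∪ Q ∪ U).filter (fun y => y < x) ⊆ L.erase x := by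
          intro y hy
          simp only [Finset.mem_filter, Finset.mem_union] at hy
          obtain ⟨(h | h) | h, hlt⟩ := hy
          · exact Finset.mem_erase.2 ⟨hlt.ne, h⟩
          · exact absurd (h1 x hx y h) (by omega)
          · exact absurd (h3 x hx y h) (by omega)
        have := Finset.card_le_card hsub
        have h4 := Finset.card_erase_lt_of_mem hx
        omega
      · exact hx
    · exfalso
      have hsub : (L ∪ Q ∪ U).filter (fun y => x < y) ⊆ U.erase x := by
        intro y hy
        simp only [Finset.mem_filter, Finset.mem_union] at hy
        obtain ⟨(h | h) | h, hlt⟩ := hy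
        · exact absurd (h3 y h x hx) (by omega)
        · exact absurd (h2 y h x hx) (by omega)
        · exact Finset.mem_erase.2 ⟨hlt.ne', h⟩
      have := Finset.card_le_card hsub
      have h4 := Finset.card_erase_lt_of_mem hx
      omega
  · intro hx
    refine ⟨by simp [hx], ?_, ?_⟩
    · rw [← hL]
      exact Finset.card_le_card fun y hy => by simp [hy, h1 y hy x hx]
    · rw [← hU]
      exact Finset.card_le_card fun y hy => by simp [hy, h2 x hx y hy]

theorem daisy_set_nonempty (ℓ r k m : ℕ) (hℓ : 0 < ℓ) :
    {n | ∀ φ : Finset ℕ → Fin ℓ, HasMonoDaisyK n r m k ℓ φ}.Nonempty := by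
  obtain ⟨n, hn⟩ := ramsey_aux ℓ hℓ (k + r) (k + m)
  refine ⟨n, fun φ => ?_⟩
  obtain ⟨Y, hY, hYc, c, hc⟩ := hn (Finset.range n) (by simp) φ
  obtain ⟨K, hK, hKc⟩ := Finset.exists_subset_card_eq (s := Y) (n := k) (by omega)
  refine ⟨K, Y \ K, hK.trans hY, Finset.sdiff_subset.trans hY, Finset.disjoint_sdiff, hKc,
    by rw [Finset.card_sdiff_of_subset hK]; omega, c, fun P hP hPc => ?_⟩
  apply hc _ (Finset.union_subset hK (hP.trans Finset.sdiff_subset))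
  rw [Finset.card_union_of_disjoint (Finset.disjoint_sdiff.mono_right hP), hKc, hPc]

theorem clique_of_daisy (ℓ r k m n s : ℕ) (hkr : k < r) (hs : k < s) (hms : (k + 1) * (s - 1) < m)
    (φ : Finset ℕ → Fin ℓ) (h : HasMonoDaisyK n r m k ℓ (fun X => φ (midPart k X))) :
    HasMonoClique n (r - k) (s - k) ℓ φ := by
  obtain ⟨K, M, hKn, hMn, hd, hKc, hMc, c, hc⟩ := h
  obtain ⟨a, ha, hac⟩ := Finset.exists_lt_card_fiber_of_mul_lt_card_of_maps_to
    (s := M) (t := Finset.range (k + 1)) (f := fun y => (K.filter (fun x => x < y)).card)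
    (n := s - 1)
    (fun y _ => by
      have := Finset.card_filter_le K (fun x => x < y)
      rw [Finset.mem_range]; omega) (by rw [Finset.card_range, hMc]; exact hms)
  have hak : a ≤ k := by rw [Finset.mem_range] at ha; omega
  set M' := M.filter (fun y => (K.filter (fun x => x < y)).card = a) with hM'
  have hM'M : M' ⊆ M := Finset.filter_subset _ _
  obtain ⟨y₀, hy₀⟩ : M'.Nonempty := Finset.card_pos.1 (by omega)
  set K1 := K.filter (fun x => x < y₀) with hK1
  have hK1c : K1.card = a := (Finset.mem_filter.1 hy₀).2
  have hsame : ∀ y ∈ M', K.filter (fun x => x < y) = K1 := by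
    intro y hy
    have hyc := (Finset.mem_filter.1 hy).2
    rcases le_total y y₀ with hle | hle
    · apply Finset.eq_of_subset_of_card_le
      · intro x hx
        simp only [hK1, Finset.mem_filter] at hx ⊢
        exact ⟨hx.1, by omega⟩
      · omega
    · symm
      apply Finset.eq_of_subset_of_card_le
      · intro x hx
        simp only [hK1, Finset.mem_filter] at hx ⊢
        exact ⟨hx.1, by omega⟩
      · omega
  have hlow : ∀ x ∈ K1, ∀ y ∈ M', x < y := by
    intro x hx y hy
    rw [← hsame y hy] at hx
    exact (Finset.mem_filter.1 hx).2
  have hK1K : K1 ⊆ K := Finset.filter_subset _ _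
  have hhigh : ∀ x ∈ K \ K1, ∀ y ∈ M', y < x := by
    intro x hx y hy
    rw [← hsame y hy] at hx
    simp only [Finset.mem_sdiff, Finset.mem_filter, not_and] at hx
    have h1 := hx.2 hx.1
    have h2 : x ≠ y := fun e => Finset.disjoint_left.1 hd hx.1 (e ▸ hM'M hy)
    omega
  obtain ⟨A, hA, hAc, hAlt⟩ := exists_initial (k - a) M' (by omega)
  have hcA := Finset.card_sdiff_of_subset hA
  obtain ⟨Y, hY, hYc, hYlt⟩ := exists_initial (s - k) (M' \ A) (by omega)
  have hcY := Finset.card_sdiff_of_subset hY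
  obtain ⟨B, hB, hBc⟩ := Finset.exists_subset_card_eq (s := (M' \ A) \ Y) (n := a) (by omega)
  have hYM : Y ⊆ M' := hY.trans Finset.sdiff_subset
  have hBA : B ⊆ M' \ A := hB.trans Finset.sdiff_subset
  have hBM : B ⊆ M' := hBA.trans Finset.sdiff_subset
  refine ⟨Y, (hYM.trans hM'M).trans hMn, hYc, c, fun Q hQ hQc => ?_⟩
  have hdAQ : Disjoint A Q := Finset.disjoint_sdiff.mono_right (hQ.trans hY)
  have hdAB : Disjoint A B := Finset.disjoint_sdiff.mono_right hBA
  have hdQB : Disjoint Q B := (Finset.disjoint_sdiff.mono_right hB).mono_left hQ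
  have hP := hc (A ∪ Q ∪ B)
    ((Finset.union_subset (Finset.union_subset hA (hQ.trans hYM)) hBM).trans hM'M)
    (by
      rw [Finset.card_union_of_disjoint (Finset.disjoint_union_left.2 ⟨hdAB, hdQB⟩),
        Finset.card_union_of_disjoint hdAQ]
      omega)
  have heq : K ∪ (A ∪ Q ∪ B) = (K1 ∪ A) ∪ Q ∪ (B ∪ (K \ K1)) := by
    ext x
    have := @hK1K x
    simp only [Finset.mem_union, Finset.mem_sdiff]
    tauto
  have hdK : Disjoint K M' := hd.mono_right hM'M
  have hmid : midPart k (K ∪ (A ∪ Q ∪ B)) = Q := by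
    rw [heq]
    apply midPart_eq
    · rw [Finset.card_union_of_disjoint (hdK.mono hK1K hA)]
      omega
    · rw [Finset.card_union_of_disjoint (hdK.symm.mono hBM Finset.sdiff_subset),
        Finset.card_sdiff_of_subset hK1K]
      omega
    · intro x hx y hy
      rcases Finset.mem_union.1 hx with hx | hx
      · exact hlow x hx y (hYM (hQ hy))
      · exact hAlt x hx y (hY (hQ hy))
    · intro x hx y hy
      rcases Finset.mem_union.1 hy with hy | hy
      · exact hYlt x (hQ hx) y (hB hy)
      · exact hhigh y hy x (hYM (hQ hx))
    · intro x hx y hy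
      rcases Finset.mem_union.1 hx with hx | hx <;> rcases Finset.mem_union.1 hy with hy | hy
      · exact hlow x hx y (hBM hy)
      · exact (hlow x hx y₀ hy₀).trans (hhigh y hy y₀ hy₀)
      · exact hAlt x hx y (hBA hy)
      · exact hhigh y hy x (hA hx)
  simp only [hmid] at hP
  exact hP

/-- For all integers `ℓ ≥ 2`, `r > k ≥ 2` and `m > r`,
`D_r(m,k;ℓ) ≥ R_{r-k}(⌈m/(k+1)⌉ - k; ℓ)`. -/
theorem daisyRamseyK_ge_ramsey_sub (ℓ r k m : ℕ) (hℓ : 2 ≤ ℓ)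
    (hk : 2 ≤ k) (hkr : k < r) (hm : r < m) :
    ramsey (r - k) (m ⌈/⌉ (k + 1) - k) ℓ ≤ daisyRamseyK r m k ℓ := by
  have hne := daisy_set_nonempty ℓ r k m (by omega)
  have hmem := Nat.sInf_mem hne
  apply Nat.sInf_le
  intro φ
  rcases Nat.lt_or_ge k (m ⌈/⌉ (k + 1)) with hs | hs
  · refine clique_of_daisy ℓ r k m _ _ hkr hs ?_ φ (hmem _)
    by_contra hcon
    have h1 : m ⌈/⌉ (k + 1) ≤ m ⌈/⌉ (k + 1) - 1 := by
      rw [ceilDiv_le_iff_le_mul (by omega)]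
      omega
    omega
  · refine ⟨∅, by simp, by simp; omega, ⟨0, by omega⟩, fun P hP hPc => ?_⟩
    rw [Finset.subset_empty.1 hP, Finset.card_empty] at hPc
    omega
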